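/- arXiv:1108.4968 — 6 statements merged into one kernel-verified Lean document; each statement's English description precedes it below -/
import Mathlib

section
/- Let f_1,…,f_m be linearly independent alternating r-linear forms on E (so that they span an m-dimensional space of alternating r-linear forms), and let V ⊆ E be an r-dimensional subspace that is isotropic for every f_i. Then the canonical map Φ : (⋀^r V)^{⊕m} → (Hom_K(V, E/V))^* is injective if and only if there is no nonzero linear combination f = c_1 f_1 + ⋯ + c_m f_m that is degenerate on an r-dimensional subspace of V (equivalently, since dim V = r, that is degenerate on V itself). -/
open Module

/-- The decomposable element `v 0 ∧ ⋯ ∧ v (r-1)` of the `r`-th exterior power. -/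
noncomputable def wedge {K : Type*} [Field K] {M : Type*} [AddCommGroup M] [Module K M]
    (r : ℕ) (v : Fin r → M) : ⋀[K]^r M :=
  ⟨ExteriorAlgebra.ιMulti K r v, ExteriorAlgebra.ιMulti_range K r (Set.mem_range_self v)⟩

/-- A subspace `W` is degenerate for an alternating `r`-linear form `f` if
`f(w₁,…,w_{r-1},e) = 0` whenever `w₁,…,w_{r-1} ∈ W` and `e ∈ E` is arbitrary. -/
def IsDegenerateOn {K : Type*} [Field K] {E : Type*} [AddCommGroup E] [Module K E]
    {r : ℕ} (f : AlternatingMap K E K (Fin r)) (W : Submodule K E) : Prop :=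
  ∀ w : Fin r → E, (∀ i : Fin r, (i : ℕ) + 1 < r → w i ∈ W) → f w = 0


theorem aux_swap {K : Type*} [Field K] {E : Type*} [AddCommGroup E] [Module K E]
    {r : ℕ} (F : AlternatingMap K E K (Fin r)) (w : Fin r → E) (σ : Equiv.Perm (Fin r))
    (h : F (w ∘ σ) = 0) : F w = 0 := by
  rw [F.map_perm] at h
  rcases Int.units_eq_one_or (Equiv.Perm.sign σ) with h1 | h1 <;> rw [h1] at h <;> simpa using h

theorem aux_sum {K : Type*} [Field K] {E : Type*} [AddCommGroup E] [Module K E]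
    {r m : ℕ} (c : Fin m → K) (f : Fin m → AlternatingMap K E K (Fin r)) (w : Fin r → E) :
    (∑ i, c i • f i) w = ∑ i, c i • f i w := by
  have : ∀ s : Finset (Fin m), (∑ i ∈ s, c i • f i) w = ∑ i ∈ s, c i • f i w := by
    intro s
    induction s using Finset.induction_on with
    | empty => simp
    | insert a s ha ih =>
      rw [Finset.sum_insert ha, Finset.sum_insert ha, AlternatingMap.add_apply, ih,
        AlternatingMap.smul_apply]
  exact this _

theorem aux_deg {K : Type*} [Field K] {E : Type*} [AddCommGroup E] [Module K E]
    {n : ℕ} (F : AlternatingMap K E K (Fin (n+1))) (V : Submodule K E)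
    (b : Basis (Fin (n+1)) K V)
    (h : ∀ j x, F (Function.update (fun l => (b l : E)) j x) = 0) :
    IsDegenerateOn F V := by
  intro w hw
  apply aux_swap F w (Equiv.swap 0 (Fin.last n))
  have key : ∀ e : E, (F.curryLeft e).compLinearMap V.subtype = 0 := by
    intro e
    refine Basis.ext_alternating b ?_
    intro s hs
    have : ∃ j, j ∉ Set.range s := by
      by_contra! hc
      have := Fintype.card_le_of_surjective s hc
      simp at this
    obtain ⟨j, hj⟩ := this
    have hinj : Function.Injective (Fin.cons j s : Fin (n+1) → Fin (n+1)) :=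
      Fin.cons_injective_iff.2 ⟨hj, hs⟩
    let σ : Equiv.Perm (Fin (n+1)) := Equiv.ofBijective _ (Finite.injective_iff_bijective.1 hinj)
    have h2 : (Matrix.vecCons e (fun i => (b (s i) : E)))
        = Function.update (fun l => (b l : E)) j e ∘ σ := by
      funext i
      refine Fin.cases ?_ (fun i => ?_) i
      · simp [σ]
      · have : s i ≠ j := fun hh => hj ⟨i, hh⟩
        simp [σ, this]
    have h3 : F (Matrix.vecCons e (fun i => (b (s i) : E))) = 0 := by
      rw [h2, F.map_perm, h, smul_zero]
    simpa using h3
  have hm : ∀ i : Fin n, w (Equiv.swap 0 (Fin.last n) i.succ) ∈ V := by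
    intro i
    apply hw
    have : Equiv.swap 0 (Fin.last n) i.succ ≠ Fin.last n := by
      intro hh
      have := congrArg (Equiv.swap 0 (Fin.last n)) hh
      simp at this
    have h5 := Fin.val_lt_last this
    simpa using h5
  have h4 := congrArg (fun G => G (fun i => (⟨_, hm i⟩ : V))) (key (w (Fin.last n)))
  simp at h4
  convert h4 using 2
  funext i
  refine Fin.cases ?_ (fun i => ?_) i <;> simp [Function.comp]

theorem aux_deg' {K : Type*} [Field K] {E : Type*} [AddCommGroup E] [Module K E]
    {n : ℕ} (F : AlternatingMap K E K (Fin (n+1))) (V : Submodule K E)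
    (b : Fin (n+1) → V) (h : IsDegenerateOn F V) (j : Fin (n+1)) (x : E) :
    F (Function.update (fun l => (b l : E)) j x) = 0 := by
  apply aux_swap F _ (Equiv.swap j (Fin.last n))
  apply h
  intro i hi
  have h1 : Equiv.swap j (Fin.last n) i ≠ j := by
    intro hh
    have := congrArg (Equiv.swap j (Fin.last n)) hh
    simp at this
    subst this
    simp at hi
  simp [Function.update_of_ne h1]

theorem aux_span {K : Type*} [Field K] {M : Type*} [AddCommGroup M] [Module K M]
    {r : ℕ} (b : Basis (Fin r) K M) (x : ⋀[K]^r M) : ∃ c : K, x = c • wedge r b := by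
  have key : exteriorPower.ιMulti K r (M := M) =
      (LinearMap.toSpanSingleton K _ (wedge (K := K) r b)).compAlternatingMap b.det := by
    refine Basis.ext_alternating b ?_
    intro s hs
    let σ : Equiv.Perm (Fin r) := Equiv.ofBijective _ (Finite.injective_iff_bijective.1 hs)
    have h : (fun i => b (s i)) = b ∘ σ := rfl
    rw [h, AlternatingMap.map_perm, AlternatingMap.map_perm]
    congr 1
    simp [b.det_self]
    rfl
  have hx : x ∈ Submodule.span K (Set.range (exteriorPower.ιMulti K r (M := M))) := by
    rw [exteriorPower.ιMulti_span]; trivial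
  have : Submodule.span K (Set.range (exteriorPower.ιMulti K r (M := M)))
      ≤ Submodule.span K {wedge (K := K) r b} := by
    rw [Submodule.span_le]
    rintro _ ⟨v, rfl⟩
    rw [key]
    exact Submodule.mem_span_singleton.2 ⟨b.det v, by simp⟩
  obtain ⟨c, hc⟩ := Submodule.mem_span_singleton.1 (this hx)
  exact ⟨c, hc.symm⟩

theorem aux_ne {K : Type*} [Field K] {M : Type*} [AddCommGroup M] [Module K M]
    {r : ℕ} (b : Basis (Fin r) K M) : wedge (K := K) r b ≠ 0 := by
  intro h
  have h1 : exteriorPower.alternatingMapLinearEquiv b.det (exteriorPower.ιMulti K r b) = 1 := by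
    rw [exteriorPower.alternatingMapLinearEquiv_apply_ιMulti, b.det_self]
  have h2 : exteriorPower.ιMulti K r b = wedge (K := K) r b := rfl
  rw [h2, h, map_zero] at h1
  exact zero_ne_one h1

/-- Let `f₁,…,f_m` be linearly independent alternating `r`-linear forms on
`E` and let `V ⊆ E` be an `r`-dimensional subspace isotropic for every `fᵢ`.  Then the
canonical map `Φ : (⋀^r V)^{⊕m} → Hom(V, E/V)*` is injective if and only if no nonzero
linear combination of the `fᵢ` is degenerate on an `r`-dimensional subspace of `V`. -/
theorem stmt_0 {K : Type*} [Field K] {E : Type*} [AddCommGroup E] [Module K E]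
    (r m : ℕ) (hr : 1 ≤ r)
    (f : Fin m → AlternatingMap K E K (Fin r)) (hf : LinearIndependent K f)
    (V : Submodule K E) (hV : finrank K V = r)
    (hiso : ∀ (i : Fin m) (v : Fin r → V), f i (fun l => (v l : E)) = 0)
    (Φ : (Fin m → ⋀[K]^r V) →ₗ[K] Module.Dual K (V →ₗ[K] E ⧸ V))
    (hΦ : ∀ (φ : V →ₗ[K] E ⧸ V) (φl : V →ₗ[K] E), (∀ v : V, V.mkQ (φl v) = φ v) →
      ∀ (i : Fin m) (v : Fin r → V),
        Φ (Pi.single i (wedge r v)) φ =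
          ∑ j : Fin r, f i (Function.update (fun l => (v l : E)) j (φl (v j)))) :
    Function.Injective Φ ↔
      ¬ ∃ c : Fin m → K, c ≠ 0 ∧ ∃ W : Submodule K E, W ≤ V ∧ finrank K W = r ∧
          IsDegenerateOn (∑ i, c i • f i) W := by
  obtain ⟨n, rfl⟩ : ∃ n, r = n + 1 := ⟨r - 1, by omega⟩
  haveI : FiniteDimensional K V := FiniteDimensional.of_finrank_pos (by omega)
  let b : Basis (Fin (n+1)) K V := finBasisOfFinrankEq K V hV
  have hform : ∀ (c : Fin m → K) (φ : V →ₗ[K] E ⧸ V) (φl : V →ₗ[K] E),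
      (∀ v : V, V.mkQ (φl v) = φ v) →
      Φ (fun i => c i • wedge (n+1) b) φ =
        ∑ j, (∑ i, c i • f i) (Function.update (fun l => (b l : E)) j (φl (b j))) := by
    intro c φ φl hl
    have h1 : (fun i => c i • wedge (K := K) (n+1) b)
        = ∑ i, c i • Pi.single i (wedge (K := K) (n+1) b) := by
      rw [← Finset.univ_sum_single (fun i => c i • wedge (K := K) (n+1) b)]
      simp [Pi.single_smul]
    rw [h1]
    simp only [map_sum, map_smul, LinearMap.sum_apply, LinearMap.smul_apply, hΦ φ φl hl,
      Finset.smul_sum]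
    rw [Finset.sum_comm]
    refine Finset.sum_congr rfl fun j _ => ?_
    exact (aux_sum c f _).symm
  constructor
  · rintro hinj ⟨c, hc, W, hWV, hW, hdeg⟩
    have hWe : W = V := Submodule.eq_of_le_of_finrank_eq hWV (by rw [hW, hV])
    subst hWe
    apply hc
    have h0 : Φ (fun i => c i • wedge (n+1) b) = 0 := by
      ext φ
      obtain ⟨φl, hl⟩ := Module.projective_lifting_property W.mkQ φ W.mkQ_surjective
      rw [hform c φ φl (fun v => by rw [← hl]; rfl)]
      exact Finset.sum_eq_zero fun j _ => aux_deg' _ W b hdeg j _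
    have h1 := hinj (h0.trans (map_zero Φ).symm)
    funext i
    have h2 := congrFun h1 i
    exact (smul_eq_zero.1 h2).resolve_right (aux_ne b)
  · intro hno
    rw [injective_iff_map_eq_zero]
    intro x hx
    choose c hc using fun i => aux_span b (x i)
    obtain rfl : x = fun i => c i • wedge (n+1) b := funext hc
    by_contra hne
    refine hno ⟨c, ?_, V, le_rfl, hV, ?_⟩
    · rintro rfl
      apply hne
      funext i
      simp
    · refine aux_deg _ V b ?_
      intro j e
      let φl : V →ₗ[K] E := b.constr K (Pi.single j e)
      have h := hform c (V.mkQ ∘ₗ φl) φl (fun v => rfl)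
      rw [hx, Finset.sum_eq_single j] at h
      · simpa [φl, Basis.constr_basis] using h.symm
      · intro k _ hk
        apply AlternatingMap.map_coord_zero _ k
        simp [φl, Basis.constr_basis, hk]
      · simp
end

section
/- Let f_1,…,f_m be alternating r-linear forms on E and let V ⊆ E be a finite-dimensional subspace of dimension k ≥ r that is isotropic for every f_i. If there exist scalars c_1,…,c_m ∈ K, not all zero, and an r-dimensional subspace W ⊆ V such that the linear combination f = c_1 f_1 + ⋯ + c_m f_m is degenerate on W, then the canonical map Φ : (⋀^r V)^{⊕m} → (Hom_K(V, E/V))^* is not injective. -/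
open Module

/-- Let `f₁,…,f_m` be alternating `r`-linear forms on `E` and let `V ⊆ E`
be a finite-dimensional subspace of dimension `k ≥ r` which is isotropic for every `fᵢ`.
If some nonzero linear combination of the `fᵢ` is degenerate on an `r`-dimensional subspace
`W ⊆ V`, then the canonical map `Φ : (⋀^r V)^{⊕m} → Hom(V, E/V)*` is not injective. -/
theorem stmt_3 {K : Type*} [Field K] {E : Type*} [AddCommGroup E] [Module K E]
    (r m k : ℕ) (hr : 1 ≤ r) (hk : r ≤ k)
    (f : Fin m → AlternatingMap K E K (Fin r))
    (V : Submodule K E) (hV : finrank K V = k) [FiniteDimensional K V]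
    (hiso : ∀ (i : Fin m) (v : Fin r → V), f i (fun l => (v l : E)) = 0)
    (hdeg : ∃ c : Fin m → K, c ≠ 0 ∧ ∃ W : Submodule K E, W ≤ V ∧ finrank K W = r ∧
      IsDegenerateOn (∑ i, c i • f i) W)
    (Φ : (Fin m → ⋀[K]^r V) →ₗ[K] Module.Dual K (V →ₗ[K] E ⧸ V))
    (hΦ : ∀ (φ : V →ₗ[K] E ⧸ V) (φl : V →ₗ[K] E), (∀ v : V, V.mkQ (φl v) = φ v) →
      ∀ (i : Fin m) (v : Fin r → V),
        Φ (Pi.single i (wedge r v)) φ =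
          ∑ j : Fin r, f i (Function.update (fun l => (v l : E)) j (φl (v j)))) :
    ¬ Function.Injective Φ := by
  classical
  obtain ⟨c, hc, W, hWV, hW, hd⟩ := hdeg
  intro hinj
  have : FiniteDimensional K W := Submodule.finiteDimensional_of_le hWV
  let b : Basis (Fin r) K W := finBasisOfFinrankEq K W hW
  let w : Fin r → V := fun j => Submodule.inclusion hWV (b j)
  have hw0 : wedge (K := K) r w ≠ 0 := by
    intro h
    obtain ⟨p, hp⟩ := LinearMap.exists_leftInverse_of_injective (Submodule.inclusion hWV)
      (LinearMap.ker_eq_bot.2 (Submodule.inclusion_injective hWV))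
    have h1 : ExteriorAlgebra.ιMulti K r w = 0 := congrArg Subtype.val h
    have h2 := ExteriorAlgebra.liftAlternating_apply_ιMulti (R := K)
      (Pi.single r (b.det.compLinearMap p) : ∀ i, V [⋀^Fin i]→ₗ[K] K) w
    rw [h1, map_zero, Pi.single_eq_same] at h2
    have h3 : (fun j => p (w j)) = b := by
      funext j
      exact LinearMap.congr_fun hp (b j)
    have h4 : (b.det.compLinearMap p) w = b.det b := by
      rw [← h3]; rfl
    rw [h4, b.det_self] at h2
    exact zero_ne_one h2
  have hz : Φ (fun i => c i • wedge r w) = 0 := by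
    apply LinearMap.ext
    intro φ
    obtain ⟨s, hs⟩ := LinearMap.exists_rightInverse_of_surjective V.mkQ V.range_mkQ
    have hx : (fun i => c i • wedge (K := K) r w) = ∑ i, c i • Pi.single i (wedge (K := K) r w) := by
      funext i
      simp [Finset.sum_apply, Pi.single_apply]
    rw [hx, map_sum]
    simp only [map_smul, LinearMap.sum_apply, LinearMap.smul_apply, LinearMap.zero_apply]
    have key := fun i => hΦ φ (s ∘ₗ φ) (fun v => LinearMap.congr_fun hs (φ v)) i w
    simp only [key, Finset.smul_sum]
    rw [Finset.sum_comm]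
    refine Finset.sum_eq_zero fun j _ => ?_
    generalize (s ∘ₗ φ) (w j) = e
    have hF : (∑ i, c i • f i) (Function.update (fun l => (w l : E)) j e) = 0 := by
      let L : Fin r := ⟨r - 1, by omega⟩
      have hsw : (∑ i, c i • f i)
          (Function.update (fun l => (w l : E)) j e ∘ Equiv.swap j L) = 0 := by
        apply hd
        intro i hi
        have hiL : i ≠ L := by
          intro h
          have := congrArg Fin.val h
          simp only [L] at this
          omega
        have hne : Equiv.swap j L i ≠ j := by
          intro h
          apply hiL
          have := congrArg (Equiv.swap j L) h
          simpa using this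
        simp only [Function.comp_apply, Function.update_of_ne hne]
        exact (b _).2
      rw [AlternatingMap.map_perm] at hsw
      exact (smul_eq_zero_iff_eq _).1 hsw
    have hsum : ∀ (t : Finset (Fin m)) (v : Fin r → E),
        (∑ i ∈ t, c i • f i) v = ∑ i ∈ t, c i • f i v := by
      intro t v
      induction t using Finset.induction_on with
      | empty => simp
      | insert a t ha ih => rw [Finset.sum_insert ha, Finset.sum_insert ha, ← ih]; rfl
    rw [hsum] at hF
    exact hF
  have h0 := hinj (hz.trans (map_zero Φ).symm)
  apply hc
  funext i
  exact (smul_eq_zero.1 (congrFun h0 i)).resolve_right hw0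
end

section
/- Let f be an alternating r-linear form on E, let V ⊆ E be a subspace that is isotropic for f, let π : E → E/V be the quotient map, and let φ : V → E/V be a K-linear map. Then: (1) for any K-linear lift φ̃ : V → E of φ (i.e., π ∘ φ̃ = φ), the map f^φ : V^r → K defined by f^φ(v_1,…,v_r) = Σ_{j=1}^r f(v_1,…,φ̃(v_j),…,v_r) is an alternating r-linear form on V; and (2) f^φ does not depend on the choice of the lift φ̃. -/
/-- Let `f` be an alternating `r`-linear form on `E`, let `V ⊆ E` be a
subspace isotropic for `f`, and let `φ : V → E/V` be a linear map. Then (1) for any linear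
lift `φ̃ : V → E` of `φ`, the map `f^φ(v₁,…,v_r) = ∑ⱼ f(v₁,…,φ̃(vⱼ),…,v_r)` is an alternating
`r`-linear form on `V`, and (2) `f^φ` is independent of the choice of lift. -/
theorem stmt_4 {K : Type*} [Field K] {E : Type*} [AddCommGroup E] [Module K E]
    (r : ℕ) (hr : 1 ≤ r) (f : AlternatingMap K E K (Fin r)) (V : Submodule K E)
    (hiso : ∀ v : Fin r → V, f (fun i => (v i : E)) = 0)
    (φ : V →ₗ[K] E ⧸ V) :
    (∀ φl : V →ₗ[K] E, (∀ v : V, V.mkQ (φl v) = φ v) →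
      ∃ g : AlternatingMap K V K (Fin r),
        ∀ v : Fin r → V,
          g v = ∑ j : Fin r, f (Function.update (fun l => (v l : E)) j (φl (v j)))) ∧
    (∀ φl₁ φl₂ : V →ₗ[K] E,
      (∀ v : V, V.mkQ (φl₁ v) = φ v) → (∀ v : V, V.mkQ (φl₂ v) = φ v) →
      ∀ v : Fin r → V,
        ∑ j : Fin r, f (Function.update (fun l => (v l : E)) j (φl₁ (v j))) =
        ∑ j : Fin r, f (Function.update (fun l => (v l : E)) j (φl₂ (v j)))) := by
  classical
  refine ⟨?_, ?_⟩
  · intro φl _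
    let F : Fin r → MultilinearMap K (fun _ : Fin r => V) K := fun j =>
      f.toMultilinearMap.compLinearMap (fun l => if l = j then φl else V.subtype)
    have hF : ∀ j (v : Fin r → V),
        F j v = f (Function.update (fun l => (v l : E)) j (φl (v j))) := by
      intro j v
      change f _ = f _
      congr 1
      funext l
      by_cases h : l = j
      · subst h
        simp
      · simp [h]
    have hS : ∀ v : Fin r → V, (∑ j, F j) v =
        ∑ j : Fin r, f (Function.update (fun l => (v l : E)) j (φl (v j))) := by
      intro v
      rw [MultilinearMap.sum_apply]
      exact Finset.sum_congr rfl (fun j _ => hF j v)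
    refine ⟨{ (∑ j, F j) with map_eq_zero_of_eq' := ?_ }, fun v => hS v⟩
    intro v a b hab hne
    change (∑ j, F j) v = 0
    rw [hS, Finset.sum_eq_add a b hne]
    · have h : Function.update (fun l => (v l : E)) b (φl (v b)) =
          Function.update (fun l => (v l : E)) a (φl (v a)) ∘ Equiv.swap a b := by
        funext l
        by_cases hb : l = b
        · subst hb
          simp [hab]
        · by_cases ha : l = a
          · subst ha
            simp [hne, hne.symm, hab]
          · simp [Equiv.swap_apply_of_ne_of_ne ha hb, ha, hb]
      rw [h, f.map_swap _ hne, add_neg_cancel]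
    · intro c _ hc
      refine f.map_eq_zero_of_eq _ ?_ hne
      simp [hc.1.symm, hc.2.symm, hab]
    · simp
    · simp
  · intro φ₁ φ₂ h₁ h₂ v
    refine Finset.sum_congr rfl (fun j _ => ?_)
    rw [← sub_eq_zero, ← f.map_update_sub]
    have hm : φ₁ (v j) - φ₂ (v j) ∈ V := by
      rw [← Submodule.Quotient.eq]
      exact (h₁ (v j)).trans (h₂ (v j)).symm
    rw [← hiso (Function.update v j ⟨_, hm⟩)]
    congr 1
    funext l
    by_cases h : l = j
    · subst h
      simp
    · simp [h]
end

section
/- Let K be a field, r ≥ 1 an integer, and V a K-vector space of dimension r + 1. Then every nonzero element ω of the exterior power ⋀^r V is decomposable: there exist linearly independent vectors v_1,…,v_r ∈ V such that ω = v_1 ∧ ⋯ ∧ v_r. -/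
open Module

theorem aux_scalar {K : Type*} [Field K] {V N : Type*} [AddCommGroup V] [Module K V]
    [AddCommGroup N] [Module K N] {n : ℕ} (U : Submodule K V) [FiniteDimensional K U]
    (hU : finrank K U = n) (f : V [⋀^Fin n]→ₗ[K] N) (e v : Fin n → V)
    (he : LinearIndependent K e) (heU : ∀ i, e i ∈ U) (hv : ∀ i, v i ∈ U) :
    ∃ k : K, f v = k • f e := by
  have he' : LinearIndependent K (fun i => (⟨e i, heU i⟩ : U)) :=
    LinearIndependent.of_comp U.subtype he
  let b : Basis (Fin n) K U := basisOfLinearIndependentOfCardEqFinrank' _ he' (by simp [hU])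
  have hb : ∀ i, (b i : V) = e i := fun i => by simp [b]
  have key : f.compLinearMap U.subtype = b.det.smulRight (f e) := by
    refine Basis.ext_alternating b fun w hw => ?_
    obtain ⟨σ, rfl⟩ : ∃ σ : Equiv.Perm (Fin n), w = σ :=
      ⟨Equiv.ofBijective w (Finite.injective_iff_bijective.1 hw), rfl⟩
    have h1 : (fun i => b (σ i)) = b ∘ σ := rfl
    rw [h1, AlternatingMap.map_perm, AlternatingMap.map_perm]
    have h2 : (fun i => (b i : V)) = e := funext hb
    congr 1
    simp [b.det_self, AlternatingMap.smulRight_apply, Function.comp_def, h2]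
  refine ⟨b.det (fun i => ⟨v i, hv i⟩), ?_⟩
  have := congrArg (fun g => g (fun i => (⟨v i, hv i⟩ : U))) key
  simpa [Function.comp_def] using this

theorem aux_cons {K : Type*} [Field K] {V N : Type*} [AddCommGroup V] [Module K V]
    [AddCommGroup N] [Module K N] {s : ℕ} (f : V [⋀^Fin (s+1)]→ₗ[K] N) (k : K) (a : V)
    (c : Fin s → V) : k • f (Fin.cons a c) = f (Fin.cons (k • a) c) := by
  have := f.map_update_smul (Fin.cons a c) 0 k a
  simpa using this.symm

theorem aux_half {K : Type*} [Field K] {V N : Type*} [AddCommGroup V] [Module K V]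
    [AddCommGroup N] [Module K N] {s : ℕ} (f : V [⋀^Fin (s+1)]→ₗ[K] N) (v : Fin (s+1) → V)
    (hv : LinearIndependent K v) (c : Fin s → V) (hc : LinearIndependent K c)
    (hcv : ∀ i, c i ∈ Submodule.span K (Set.range v)) :
    ∃ a, f v = f (Fin.cons a c) := by
  set U := Submodule.span K (Set.range v) with hUdef
  have hU : finrank K U = s + 1 := by
    simpa using finrank_span_eq_card hv
  haveI : FiniteDimensional K U := FiniteDimensional.span_of_finite K (Set.finite_range v)
  obtain ⟨a, haU, ha⟩ : ∃ a ∈ U, a ∉ Submodule.span K (Set.range c) := by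
    by_contra! h
    haveI : FiniteDimensional K (Submodule.span K (Set.range c)) :=
      FiniteDimensional.span_of_finite K (Set.finite_range c)
    have h1 := Submodule.finrank_mono (show U ≤ Submodule.span K (Set.range c) from h)
    have h2 : finrank K (Submodule.span K (Set.range c)) = s := by
      simpa using finrank_span_eq_card hc
    omega
  obtain ⟨k, hk⟩ := aux_scalar U hU f (Fin.cons a c) v
    (linearIndependent_finCons.2 ⟨hc, ha⟩)
    (fun i => by refine Fin.cases ?_ (fun j => ?_) i
                 · simpa using haU
                 · simpa using hcv j)
    (fun i => Submodule.subset_span ⟨i, rfl⟩)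
  exact ⟨k • a, by rw [hk, aux_cons]⟩

theorem aux_pair {K : Type*} [Field K] {V N : Type*} [AddCommGroup V] [Module K V]
    [AddCommGroup N] [Module K N] {s : ℕ} (hV : finrank K V = s + 1 + 1)
    (f : V [⋀^Fin (s+1)]→ₗ[K] N) (v w : Fin (s+1) → V) :
    ∃ (c : Fin s → V) (a b : V), f v = f (Fin.cons a c) ∧ f w = f (Fin.cons b c) := by
  have hz : ∀ c : Fin s → V, f (Fin.cons 0 c) = 0 := fun c =>
    f.map_coord_zero 0 (by simp)
  by_cases hv : LinearIndependent K v
  swap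
  · exact ⟨Fin.tail w, 0, w 0, by rw [f.map_linearDependent v hv, hz], by simp⟩
  by_cases hw : LinearIndependent K w
  swap
  · exact ⟨Fin.tail v, v 0, 0, by simp, by rw [f.map_linearDependent w hw, hz]⟩
  haveI : FiniteDimensional K V := FiniteDimensional.of_finrank_pos (by omega)
  set U := Submodule.span K (Set.range v) with hUdef
  set W := Submodule.span K (Set.range w) with hWdef
  have hU : finrank K U = s + 1 := by simpa using finrank_span_eq_card hv
  have hW : finrank K W = s + 1 := by simpa using finrank_span_eq_card hw
  have h1 := Submodule.finrank_sup_add_finrank_inf_eq U W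
  have h2 := Submodule.finrank_le (U ⊔ W)
  have h3 : s ≤ finrank K (U ⊓ W : Submodule K V) := by omega
  let b := finBasis K (U ⊓ W : Submodule K V)
  let c : Fin s → V := fun i => (b (Fin.castLE h3 i) : V)
  have hc : LinearIndependent K c :=
    (b.linearIndependent.map' (U ⊓ W).subtype (Submodule.ker_subtype _)).comp _
      (Fin.castLE_injective h3)
  obtain ⟨a, ha⟩ := aux_half f v hv c hc (fun i => (b (Fin.castLE h3 i)).2.1)
  obtain ⟨a', ha'⟩ := aux_half f w hw c hc (fun i => (b (Fin.castLE h3 i)).2.2)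
  exact ⟨c, a, a', ha, ha'⟩

/-- If `V` is a `K`-vector space of dimension `r + 1`, then every nonzero
element of `⋀^r V` is decomposable: it equals `v₁ ∧ ⋯ ∧ v_r` for some linearly independent
vectors `v₁,…,v_r ∈ V`. -/
theorem stmt_6 {K : Type*} [Field K] {V : Type*} [AddCommGroup V] [Module K V]
    (r : ℕ) (hr : 1 ≤ r) (hV : finrank K V = r + 1)
    (ω : ⋀[K]^r V) (hω : ω ≠ 0) :
    ∃ v : Fin r → V, LinearIndependent K v ∧ ω = wedge r v := by
  obtain ⟨s, rfl⟩ : ∃ s, r = s + 1 := ⟨r - 1, by omega⟩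
  have hdec : ∃ v : Fin (s + 1) → V, ω = exteriorPower.ιMulti K (s + 1) v := by
    have hmem : ω ∈ Submodule.span K (Set.range (exteriorPower.ιMulti K (s + 1) (M := V))) := by
      rw [exteriorPower.ιMulti_span]; trivial
    clear hω
    induction hmem using Submodule.span_induction with
    | mem x hx => obtain ⟨v, rfl⟩ := hx; exact ⟨v, rfl⟩
    | zero => exact ⟨0, ((exteriorPower.ιMulti K (s + 1)).map_zero).symm⟩
    | add x y _ _ hx hy =>
      obtain ⟨v, rfl⟩ := hx
      obtain ⟨w, rfl⟩ := hy
      obtain ⟨c, a, b, h1, h2⟩ := aux_pair hV (exteriorPower.ιMulti K (s + 1)) v w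
      refine ⟨Fin.cons (a + b) c, ?_⟩
      rw [h1, h2]
      have := (exteriorPower.ιMulti K (s + 1)).map_update_add (Fin.cons a c) 0 a b
      simpa only [Fin.update_cons_zero] using this.symm
    | smul k x _ hx =>
      obtain ⟨v, rfl⟩ := hx
      refine ⟨Fin.cons (k • v 0) (Fin.tail v), ?_⟩
      rw [← aux_cons, Fin.cons_self_tail]
  obtain ⟨v, rfl⟩ := hdec
  refine ⟨v, ?_, rfl⟩
  by_contra hv
  exact hω ((exteriorPower.ιMulti K (s + 1)).map_linearDependent v hv)
end

section
/- Let f be an alternating 3-linear form on E, let V ⊆ E be a finite-dimensional subspace of dimension k that is isotropic for f, and let v_1,…,v_k be a basis of V. Suppose ω ∈ ⋀^3 V is of the form ω = v_1 ∧ v_2 ∧ v_3 + η, where η lies in the image of ⋀^3 span(v_2,…,v_k) → ⋀^3 V, and suppose ω lies in the kernel of the canonical map Φ : ⋀^3 V → (Hom_K(V, E/V))^*. Then f(e, v_2, v_3) = 0 for all e ∈ E; that is, the 2-dimensional subspace span(v_2, v_3) is degenerate for f. -/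
open Module

/-- Let `f` be an alternating `3`-linear form on `E`, let `V ⊆ E` be a
`k`-dimensional isotropic subspace with basis `v₁,…,v_k`, and suppose
`ω = v₁ ∧ v₂ ∧ v₃ + η ∈ ⋀^3 V` with `η` coming from `⋀^3 span(v₂,…,v_k)`.  If `ω` lies in
the kernel of the canonical map `Φ : ⋀^3 V → Hom(V, E/V)*`, then `f(e, v₂, v₃) = 0` for all
`e ∈ E`, i.e. `span(v₂, v₃)` is degenerate for `f`. -/
theorem stmt_8 {K : Type*} [Field K] {E : Type*} [AddCommGroup E] [Module K E]
    (f : AlternatingMap K E K (Fin 3))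
    (V : Submodule K E) (k : ℕ) (hk : 3 ≤ k) (hV : finrank K V = k)
    (hiso : ∀ v : Fin 3 → V, f (fun l => (v l : E)) = 0)
    (b : Basis (Fin k) K V)
    (ω : ⋀[K]^3 V)
    (hdecomp :
      ((ω - wedge 3 (fun i : Fin 3 => b (Fin.castLE hk i)) : ⋀[K]^3 V) : ExteriorAlgebra K V) ∈
        Submodule.map
          (ExteriorAlgebra.map
            (Submodule.span K (⇑b '' {i : Fin k | i ≠ Fin.castLE hk 0})).subtype).toLinearMap
          (⋀[K]^3 (Submodule.span K (⇑b '' {i : Fin k | i ≠ Fin.castLE hk 0}))))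
    (Φ : (⋀[K]^3 V : Submodule K (ExteriorAlgebra K V)) →ₗ[K] Module.Dual K (V →ₗ[K] E ⧸ V))
    (hΦ : ∀ (φ : V →ₗ[K] E ⧸ V) (φl : V →ₗ[K] E), (∀ v : V, V.mkQ (φl v) = φ v) →
      ∀ v : Fin 3 → V,
        Φ (wedge 3 v) φ =
          ∑ j : Fin 3, f (Function.update (fun l => (v l : E)) j (φl (v j))))
    (hker : Φ ω = 0) :
    ∀ e : E, f ![e, (b (Fin.castLE hk 1) : E), (b (Fin.castLE hk 2) : E)] = 0 := by
  intro e
  set i0 : Fin k := Fin.castLE hk 0 with hi0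
  let φl : V →ₗ[K] E := (b.coord i0).smulRight e
  let φ : V →ₗ[K] E ⧸ V := V.mkQ ∘ₗ φl
  have hW : ∀ w ∈ Submodule.span K (⇑b '' {i : Fin k | i ≠ i0}), φl w = 0 := by
    intro w hw
    have : Submodule.span K (⇑b '' {i : Fin k | i ≠ i0}) ≤ LinearMap.ker φl := by
      rw [Submodule.span_le]
      rintro _ ⟨i, hi, rfl⟩
      have hi' : i ≠ i0 := hi
      simp [φl, Finsupp.single_apply, hi']
    exact this hw
  let L : (⋀[K]^3 V : Submodule K (ExteriorAlgebra K V)) →ₗ[K] K := (LinearMap.applyₗ φ) ∘ₗ Φ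
  have hle : Submodule.map
          (ExteriorAlgebra.map
            (Submodule.span K (⇑b '' {i : Fin k | i ≠ i0})).subtype).toLinearMap
          (⋀[K]^3 (Submodule.span K (⇑b '' {i : Fin k | i ≠ i0}))) ≤
        Submodule.map (Submodule.subtype _) (LinearMap.ker L) := by
    rw [← ExteriorAlgebra.ιMulti_span_fixedDegree, Submodule.map_span, Submodule.span_le]
    rintro _ ⟨_, ⟨w, rfl⟩, rfl⟩
    refine ⟨wedge 3 (fun i => (w i : V)), ?_, ?_⟩
    · have h := hΦ φ φl (fun _ => rfl) (fun i => (w i : V))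
      change Φ _ φ = 0
      rw [h]
      refine Finset.sum_eq_zero fun j _ => ?_
      rw [hW _ (w j).2]
      exact f.map_update_zero _ _
    · simp only [AlgHom.toLinearMap_apply, ExteriorAlgebra.map_apply_ιMulti]
      rfl
  obtain ⟨η, hη, hη'⟩ := hle hdecomp
  have hη2 : η = ω - wedge 3 (fun i : Fin 3 => b (Fin.castLE hk i)) := Subtype.ext hη'
  have h1 : Φ η φ = 0 := hη
  rw [hη2, map_sub, hker, zero_sub, LinearMap.neg_apply, neg_eq_zero,
    hΦ φ φl (fun _ => rfl), Fin.sum_univ_three] at h1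
  have e0 : φl (b (Fin.castLE hk 0)) = e := by simp [φl, hi0]
  have e1 : φl (b (Fin.castLE hk 1)) = 0 :=
    hW _ (Submodule.subset_span ⟨_, by simp [hi0, Fin.ext_iff], rfl⟩)
  have e2 : φl (b (Fin.castLE hk 2)) = 0 :=
    hW _ (Submodule.subset_span ⟨_, by simp [hi0, Fin.ext_iff], rfl⟩)
  rw [e0, e1, e2, f.map_update_zero, f.map_update_zero, add_zero, add_zero] at h1
  rw [← h1]
  congr 1
  funext l
  fin_cases l <;> simp
end

section
/- Let f be an alternating r-linear form on E and let V ⊆ E be a finite-dimensional subspace that is isotropic for f. If v_1,…,v_r ∈ V are linearly independent vectors such that the decomposable element v_1 ∧ ⋯ ∧ v_r ∈ ⋀^r V lies in the kernel of the canonical map Φ : ⋀^r V → (Hom_K(V, E/V))^*, then the r-dimensional subspace span(v_1,…,v_r) is degenerate for f. -/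
open Module

/-- Let `f` be an alternating `r`-linear form on `E` and `V ⊆ E` a
finite-dimensional subspace isotropic for `f`.  If `v₁,…,v_r ∈ V` are linearly independent
and the decomposable element `v₁ ∧ ⋯ ∧ v_r ∈ ⋀^r V` lies in the kernel of the canonical
map `Φ : ⋀^r V → Hom(V, E/V)*`, then `span(v₁,…,v_r)` is degenerate for `f`. -/
theorem stmt_9 {K : Type*} [Field K] {E : Type*} [AddCommGroup E] [Module K E]
    (r : ℕ) (hr : 1 ≤ r)
    (f : AlternatingMap K E K (Fin r))
    (V : Submodule K E) [FiniteDimensional K V]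
    (hiso : ∀ v : Fin r → V, f (fun l => (v l : E)) = 0)
    (v : Fin r → V) (hv : LinearIndependent K v)
    (Φ : (⋀[K]^r V : Submodule K (ExteriorAlgebra K V)) →ₗ[K] Module.Dual K (V →ₗ[K] E ⧸ V))
    (hΦ : ∀ (φ : V →ₗ[K] E ⧸ V) (φl : V →ₗ[K] E), (∀ v' : V, V.mkQ (φl v') = φ v') →
      ∀ w : Fin r → V,
        Φ (wedge r w) φ =
          ∑ j : Fin r, f (Function.update (fun l => (w l : E)) j (φl (w j))))
    (hker : Φ (wedge r v) = 0) :
    IsDegenerateOn f (Submodule.span K (Set.range fun i => (v i : E))) := by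
  classical
  have h1 : ∀ (j : Fin r) (e : E), f (Function.update (fun l => (v l : E)) j e) = 0 := by
    intro j e
    obtain ⟨φl, hφl⟩ : ∃ φl : V →ₗ[K] E, ∀ i, φl (v i) = if i = j then e else 0 := by
      refine ⟨(Basis.extend hv.linearIndepOn_id).constr K
        (fun x => if (x : V) = v j then e else 0), fun i => ?_⟩
      have hm : v i ∈ hv.linearIndepOn_id.extend (Set.subset_univ _) :=
        hv.linearIndepOn_id.subset_extend _ (Set.mem_range_self i)
      have hb : Basis.extend hv.linearIndepOn_id ⟨v i, hm⟩ = v i := by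
        simp [Basis.extend_apply_self]
      rw [← hb, Basis.constr_basis]
      simp [hv.injective.eq_iff]
    have h := hΦ (V.mkQ ∘ₗ φl) φl (fun _ => rfl) v
    rw [hker, LinearMap.zero_apply, Finset.sum_eq_single j] at h
    · rw [hφl, if_pos rfl] at h
      exact h.symm
    · intro b _ hb
      rw [hφl, if_neg hb]
      exact f.map_coord_zero b (by simp)
    · simp
  intro w hw
  let z : Fin r := ⟨r - 1, by omega⟩
  have hw' : ∀ i : Fin r, i ≠ z → ∃ c : Fin r → K, ∑ k, c k • (v k : E) = w i := by
    intro i hi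
    have : (i : ℕ) + 1 < r := by
      have h2 : (i : ℕ) ≠ r - 1 := fun h => hi (Fin.ext h)
      have := i.2
      omega
    exact (Submodule.mem_span_range_iff_exists_fun K).1 (hw i this)
  have hw2 : ∀ i : Fin r, ∃ c : Fin r → K,
      ∑ k, c k • (if i = z then w z else (v k : E)) = w i := by
    intro i
    by_cases hi : i = z
    · refine ⟨Pi.single z 1, ?_⟩
      subst hi
      simp [← Finset.sum_smul]
    · simpa [hi] using hw' i hi
  choose c hc using hw2
  have hwe : w = fun i => ∑ k, c i k • (if i = z then w z else (v k : E)) :=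
    funext fun i => (hc i).symm
  have hexp : f w = f.toMultilinearMap
      (fun i => ∑ k, c i k • (if i = z then w z else (v k : E))) := by
    rw [← hwe]; rfl
  rw [hexp, MultilinearMap.map_sum]
  refine Finset.sum_eq_zero fun σ _ => ?_
  rw [MultilinearMap.map_smul_univ]
  refine smul_eq_zero_of_right _ ?_
  obtain ⟨j, -, hj⟩ : ∃ j ∈ (Finset.univ : Finset (Fin r)),
      j ∉ (Finset.univ.erase z).image σ := by
    apply Finset.exists_mem_notMem_of_card_lt_card
    refine lt_of_le_of_lt Finset.card_image_le ?_
    exact Finset.card_erase_lt_of_mem (Finset.mem_univ z)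
  have hj' : ∀ i, i ≠ z → σ i ≠ j := fun i hi h =>
    hj (Finset.mem_image.2 ⟨i, by simp [hi], h⟩)
  have key : (fun i => if i = z then w z else (v (σ i) : E)) =
      (Function.update (fun l => (v l : E)) j (w z)) ∘ (Function.update σ z j) := by
    funext i
    by_cases hi : i = z
    · subst hi; simp
    · simp [hi, hj' i hi]
  change f (fun i => if i = z then w z else (v (σ i) : E)) = 0
  rw [key]
  by_cases hinj : Function.Injective (Function.update σ z j)
  · have := f.map_perm (Function.update (fun l => (v l : E)) j (w z))
      (Equiv.ofBijective _ (Finite.injective_iff_bijective.1 hinj))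
    rw [h1, smul_zero] at this
    exact this
  · simp only [Function.Injective, not_forall] at hinj
    obtain ⟨a, b, hab, hne⟩ := hinj
    exact f.map_eq_zero_of_eq _ (by simp only [Function.comp_apply, hab]) hne
end
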